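/- arXiv:2003.10438 — 3 statements merged into one kernel-verified Lean document; each statement's English description precedes it below -/
import Mathlib

section
/- Let α, β, α′, β′ be four angles, each strictly between 0 and π/2 (proper acute angles). If α + β = α′ + β′ and sin(α)/sin(β) = sin(α′)/sin(β′), then α = α′ and β = β′. -/
open Real

theorem nonlinear_lemma (α β α' β' : ℝ)
    (hα : 0 < α) (hα2 : α < π / 2)
    (hβ : 0 < β) (hβ2 : β < π / 2)
    (hα' : 0 < α') (hα'2 : α' < π / 2)
    (hβ' : 0 < β') (hβ'2 : β' < π / 2)
    (hsum : α + β = α' + β')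
    (hratio : Real.sin α / Real.sin β = Real.sin α' / Real.sin β') :
    α = α' ∧ β = β' := by
  have hβ_eq : β = (α + β) - α := by ring
  have hβ'_eq : β' = (α + β) - α' := by linarith
  rw [div_eq_div_iff (sin_pos_of_pos_of_lt_pi hβ (by linarith)).ne'
    (sin_pos_of_pos_of_lt_pi hβ' (by linarith)).ne'] at hratio
  have hprod : Real.sin (α + β) * Real.sin (α - α') = 0 := by
    have h : Real.sin α * Real.sin ((α + β) - α') = Real.sin α' * Real.sin ((α + β) - α) := by
      rwa [← hβ'_eq, ← hβ_eq]
    rw [Real.sin_sub (α + β) α', Real.sin_sub (α + β) α] at h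
    rw [Real.sin_sub α α']
    linear_combination h
  have hsin : Real.sin (α - α') = 0 :=
    (mul_eq_zero.mp hprod).resolve_left
      (sin_pos_of_pos_of_lt_pi (by linarith) (by linarith)).ne'
  have hdiff : α - α' = 0 :=
    (Real.sin_eq_zero_iff_of_lt_of_lt (by linarith) (by linarith)).mp hsin
  constructor <;> linarith
end

section
/- In the Euclidean plane ℝ², let U, V, N, P, Q be points and let α, β, γ be angles with 0 < α, 0 < β, 0 < γ and α + β + γ = π/3. Assume dist(U, N) = dist(V, N); that P, U, N are not collinear with ∠(U, P, N) = β and ∠(P, U, N) = γ + π/3; that Q, V, N are not collinear with ∠(V, Q, N) = α and ∠(Q, V, N) = γ + π/3; and that P, N, Q are not collinear with ∠(P, N, Q) = γ + 2π/3. Then ∠(N, P, Q) = β and ∠(N, Q, P) = α. -/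
open Real EuclideanGeometry

/-- Two pairs of positive angles with the same sum, less than `π`, and proportional sines
coincide. -/
theorem eq_of_add_eq_add_of_sin_mul_sin_eq {a b x y : ℝ} (ha : 0 < a) (hb : 0 < b)
    (hx : 0 ≤ x) (hy : 0 ≤ y) (hlt : a + b < π) (hadd : x + y = a + b)
    (hsin : sin a * sin y = sin x * sin b) : x = a := by
  obtain rfl : y = a + b - x := by linarith
  have hS : 0 < sin (a + b) := sin_pos_of_pos_of_lt_pi (by linarith) hlt
  have h : sin (a + b) * sin (x - a) = 0 := by
    have hb' : sin b = sin (a + b - a) := by ring_nf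
    rw [hb', sin_sub (a + b) x, sin_sub (a + b) a] at hsin
    rw [sin_sub x a]
    linear_combination -hsin
  have h0 : x - a = 0 :=
    (sin_eq_zero_iff_of_lt_of_lt (by linarith) (by linarith)).1
      ((mul_eq_zero.1 h).resolve_left hS.ne')
  linarith

theorem equality_of_angle_pairs
    (U V N P Q : EuclideanSpace ℝ (Fin 2)) (α β γ : ℝ)
    (hα : 0 < α) (hβ : 0 < β) (hγ : 0 < γ)
    (hsum : α + β + γ = π / 3)
    (hZ : dist U N = dist V N)
    (hPUN : ¬ Collinear ℝ ({P, U, N} : Set (EuclideanSpace ℝ (Fin 2))))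
    (hP1 : ∠ U P N = β)
    (hP2 : ∠ P U N = γ + π / 3)
    (hQVN : ¬ Collinear ℝ ({Q, V, N} : Set (EuclideanSpace ℝ (Fin 2))))
    (hQ1 : ∠ V Q N = α)
    (hQ2 : ∠ Q V N = γ + π / 3)
    (hPNQ : ¬ Collinear ℝ ({P, N, Q} : Set (EuclideanSpace ℝ (Fin 2))))
    (hN : ∠ P N Q = γ + 2 * π / 3) :
    ∠ N P Q = β ∧ ∠ N Q P = α := by
  have hPN : P ≠ N := ne₁₂_of_not_collinear hPNQ
  have hadd : ∠ N Q P + ∠ N P Q = α + β := by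
    linarith [angle_add_angle_add_angle_eq_pi Q hPN, angle_comm P N Q, angle_comm N P Q,
      angle_comm P Q N]
  have hsin : sin α * sin (∠ N P Q) = sin (∠ N Q P) * sin β := by
    have hU := law_sin U P N
    have hV := law_sin V Q N
    have hT := law_sin P Q N
    rw [angle_comm N U P, hP1, hP2, dist_comm N U, hZ] at hU
    rw [angle_comm N V Q, hQ1, hQ2, dist_comm N V, dist_comm Q N] at hV
    rw [angle_comm P Q N, dist_comm Q N, dist_comm N P] at hT
    refine mul_right_cancel₀ (dist_ne_zero.2 hPN) ?_
    linear_combination (-sin α) * hT + sin (∠ N Q P) * (hV - hU)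
  have h := eq_of_add_eq_add_of_sin_mul_sin_eq hα hβ (angle_nonneg N Q P) (angle_nonneg N P Q)
    (by linarith [pi_pos]) hadd hsin
  exact ⟨by linarith, h⟩
end

section
/- Morley's trisector theorem: In the Euclidean plane ℝ², let A, B, C be three affinely independent points (a nondegenerate triangle). Let P, Q, R be points in the interior of the triangle (the interior of the convex hull of {A, B, C}) satisfying the adjacent-trisector angle conditions: ∠(P, B, C) = ∠(A, B, C)/3 and ∠(P, C, B) = ∠(A, C, B)/3; ∠(Q, C, A) = ∠(A, C, B)/3 and ∠(Q, A, C) = ∠(B, A, C)/3; ∠(R, A, B) = ∠(B, A, C)/3 and ∠(R, B, A) = ∠(A, B, C)/3. Then the triangle PQR is equilateral: dist(P, Q) = dist(Q, R) and dist(Q, R) = dist(R, P). -/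
open Real EuclideanGeometry

open scoped NNReal

theorem mem_span_nnreal_pair_of_smul_eq {V : Type*} [AddCommGroup V] [Module ℝ V] {x y z : V}
    {k a b : ℝ} (hk : 0 < k) (ha : 0 ≤ a) (hb : 0 ≤ b) (h : k • y = a • x + b • z) :
    y ∈ Submodule.span ℝ≥0 {x, z} := by
  rw [Submodule.mem_span_pair]
  refine ⟨⟨a / k, by positivity⟩, ⟨b / k, by positivity⟩, ?_⟩
  change (a / k) • x + (b / k) • z = y
  have : y = k⁻¹ • (k • y) := by rw [smul_smul, inv_mul_cancel₀ hk.ne', one_smul]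
  rw [this, h, smul_add, smul_smul, smul_smul]
  congr 2 <;> field

/-- In the cone spanned by `x` and `y`, the rays trisecting the angle between `x` and `y` enclose a
third of that angle. -/
theorem InnerProductGeometry.angle_trisectors {V : Type*} [NormedAddCommGroup V]
    [InnerProductSpace ℝ V] {x y q r : V} {a b c d : ℝ} (ha : 0 ≤ a) (hb : 0 ≤ b) (hc : 0 ≤ c)
    (hd : 0 ≤ d) (hq : q = a • x + b • y) (hr : r = c • x + d • y)
    (hpos : 0 < angle x y) (hqy : angle q y = angle x y / 3) (hrx : angle r x = angle x y / 3) :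
    angle q r = angle x y / 3 := by
  have hpi := angle_le_pi x y
  have hq0 : q ≠ 0 := by
    rintro rfl
    rw [angle_zero_left] at hqy
    linarith [pi_pos]
  have hr0 : r ≠ 0 := by
    rintro rfl
    rw [angle_zero_left] at hrx
    linarith [pi_pos]
  have hxq := angle_eq_angle_add_add_angle_add_of_mem_span hq0
    (mem_span_nnreal_pair_of_smul_eq one_pos ha hb (by rw [one_smul, hq]))
  rw [angle_comm] at hrx
  rcases le_or_gt (d * a) (b * c) with h | h
  · have hb' : 0 < b := by
      refine hb.lt_of_ne fun hb0 => ?_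
      rw [← hb0, zero_smul, add_zero] at hq
      have ha' : 0 < a := ha.lt_of_ne fun ha0 => hq0 (by rw [hq, ← ha0, zero_smul])
      rw [hq, angle_smul_left_of_pos _ _ ha'] at hqy
      linarith
    have := angle_eq_angle_add_add_angle_add_of_mem_span (x := x) (z := q) hr0
      (mem_span_nnreal_pair_of_smul_eq hb' (sub_nonneg.2 h) hd (by rw [hq, hr]; module))
    rw [angle_comm q r]
    linarith
  · have hd' : 0 < d := by
      refine hd.lt_of_ne fun hd0 => ?_
      rw [← hd0, zero_mul] at h
      exact (mul_nonneg hb hc).not_gt h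
    have := angle_eq_angle_add_add_angle_add_of_mem_span (x := x) (z := r) hq0
      (mem_span_nnreal_pair_of_smul_eq hd' (sub_nonneg.2 h.le) hb (by rw [hq, hr]; module))
    linarith [angle_nonneg q r]

theorem exists_sub_eq_smul_add_smul_of_mem_convexHull {V : Type*} [AddCommGroup V] [Module ℝ V]
    {A B C X : V} (h : X ∈ convexHull ℝ {A, B, C}) :
    ∃ a b : ℝ, 0 ≤ a ∧ 0 ≤ b ∧ X - A = a • (B - A) + b • (C - A) := by
  rw [convexHull_insert (Set.insert_nonempty _ _), convexHull_pair, mem_convexJoin] at h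
  obtain ⟨_, rfl, Y, ⟨s, t, hs, ht, hst, rfl⟩, u, v, hu, hv, huv, rfl⟩ := h
  refine ⟨v * s, v * t, by positivity, by positivity, ?_⟩
  obtain rfl : u = 1 - v := by linarith
  obtain rfl : s = 1 - t := by linarith
  module

theorem Real.sin_three_mul_eq_mul_sin_mul_sin (x : ℝ) :
    sin (3 * x) = 4 * sin x * sin (π / 3 + x) * sin (π / 3 - x) := by
  rw [sin_three_mul, sin_add, sin_sub, sin_pi_div_three, cos_pi_div_three]
  linear_combination (-3 * sin x) * sin_sq_add_cos_sq x
    + (-sin x * cos x ^ 2) * sq_sqrt (show (0 : ℝ) ≤ 3 by norm_num)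

theorem Real.sin_sq_add_sin_sq_sub_of_add_add_eq_pi {x y z : ℝ} (h : x + y + z = π) :
    sin x ^ 2 + sin y ^ 2 - 2 * sin x * sin y * cos z = sin z ^ 2 := by
  obtain rfl : z = π - (x + y) := by linarith
  rw [sin_pi_sub, cos_pi_sub, sin_add, cos_add]
  linear_combination (-sin x ^ 2) * sin_sq_add_cos_sq y + (-sin y ^ 2) * sin_sq_add_cos_sq x

section Morley

variable {V P : Type*} [NormedAddCommGroup V] [InnerProductSpace ℝ V] [MetricSpace P]
  [NormedAddTorsor V P]

theorem dist_of_angle_eq_trisectors {A B R : P} {k α β γ : ℝ} (hα : 0 < α) (hβ : 0 < β)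
    (hγ : 0 < γ) (hsum : α + β + γ = π / 3) (hAB : A ≠ B) (hk : dist A B = k * sin (3 * γ))
    (hRA : ∠ R A B = α) (hRB : ∠ R B A = β) :
    dist A R = 4 * k * sin β * sin γ * sin (π / 3 + γ) := by
  have hang := angle_add_angle_add_angle_eq_pi R hAB.symm
  have hlaw := law_sin B R A
  have hBRA : ∠ B R A = π - (π / 3 - γ) := by
    rw [angle_comm A B R, angle_comm B R A, hRB, angle_comm R A B] at *
    linarith
  rw [hBRA, sin_pi_sub, angle_comm, hRB, hk, sin_three_mul_eq_mul_sin_mul_sin] at hlaw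
  have hpos : 0 < sin (π / 3 - γ) := sin_pos_of_pos_of_lt_pi (by linarith) (by linarith [pi_pos])
  rw [dist_comm]
  apply mul_left_cancel₀ hpos.ne'
  linear_combination hlaw

theorem dist_adjacent_trisectors {A B C Q R : V} {k α β γ : ℝ} (hα : 0 < α) (hβ : 0 < β)
    (hγ : 0 < γ) (hsum : α + β + γ = π / 3) (hA : ∠ B A C = 3 * α)
    (hAB : A ≠ B) (hAC : A ≠ C)
    (hkB : dist A B = k * sin (3 * γ)) (hkC : dist A C = k * sin (3 * β)) (hk : 0 < k)
    (hQ : Q ∈ convexHull ℝ {A, B, C}) (hR : R ∈ convexHull ℝ {A, B, C})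
    (hQC : ∠ Q C A = γ) (hQA : ∠ Q A C = α) (hRA : ∠ R A B = α) (hRB : ∠ R B A = β) :
    dist Q R = 4 * k * sin α * sin β * sin γ := by
  have hAR := dist_of_angle_eq_trisectors hα hβ hγ hsum hAB hkB hRA hRB
  have hAQ := dist_of_angle_eq_trisectors hα hγ hβ (by linarith) hAC hkC hQA hQC
  obtain ⟨a, b, ha, hb, hq⟩ := exists_sub_eq_smul_add_smul_of_mem_convexHull hQ
  obtain ⟨c, d, hc, hd, hr⟩ := exists_sub_eq_smul_add_smul_of_mem_convexHull hR
  have hQAR : ∠ Q A R = α := by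
    have hA' : InnerProductGeometry.angle (B - A) (C - A) = 3 * α := hA
    have := InnerProductGeometry.angle_trisectors ha hb hc hd hq hr (by linarith)
      (by rw [hA']; exact hQA.trans (by ring)) (by rw [hA']; exact hRA.trans (by ring))
    rw [hA'] at this
    exact this.trans (by ring)
  have hcos := law_cos Q A R
  have hsin := sin_sq_add_sin_sq_sub_of_add_add_eq_pi
    (show (π / 3 + β) + (π / 3 + γ) + α = π by linarith)
  rw [dist_comm Q A, dist_comm R A, hAQ, hAR, hQAR] at hcos
  have hpi := pi_pos
  have hsα : 0 < sin α := sin_pos_of_pos_of_lt_pi hα (by linarith)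
  have hsβ : 0 < sin β := sin_pos_of_pos_of_lt_pi hβ (by linarith)
  have hsγ : 0 < sin γ := sin_pos_of_pos_of_lt_pi hγ (by linarith)
  rw [← sq_eq_sq₀ dist_nonneg (by positivity)]
  linear_combination hcos + (4 * k * sin β * sin γ) ^ 2 * hsin

end Morley

theorem morley_trisector
    (A B C P Q R : EuclideanSpace ℝ (Fin 2))
    (hABC : AffineIndependent ℝ ![A, B, C])
    (hP : P ∈ interior (convexHull ℝ ({A, B, C} : Set (EuclideanSpace ℝ (Fin 2)))))
    (hQ : Q ∈ interior (convexHull ℝ ({A, B, C} : Set (EuclideanSpace ℝ (Fin 2)))))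
    (hR : R ∈ interior (convexHull ℝ ({A, B, C} : Set (EuclideanSpace ℝ (Fin 2)))))
    (hP1 : ∠ P B C = ∠ A B C / 3)
    (hP2 : ∠ P C B = ∠ A C B / 3)
    (hQ1 : ∠ Q C A = ∠ A C B / 3)
    (hQ2 : ∠ Q A C = ∠ B A C / 3)
    (hR1 : ∠ R A B = ∠ B A C / 3)
    (hR2 : ∠ R B A = ∠ A B C / 3) :
    dist P Q = dist Q R ∧ dist Q R = dist R P := by
  rw [affineIndependent_iff_not_collinear_set] at hABC
  have hset₁ : ({A, B, C} : Set (EuclideanSpace ℝ (Fin 2))) = {B, C, A} := by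
    ext; simp; tauto
  have hset₂ : ({A, B, C} : Set (EuclideanSpace ℝ (Fin 2))) = {C, A, B} := by
    ext; simp; tauto
  have hAB := ne₁₂_of_not_collinear hABC
  have hAC := ne₁₃_of_not_collinear hABC
  have hBC := ne₂₃_of_not_collinear hABC
  have hsum := angle_add_angle_add_angle_eq_pi C hAB.symm
  have hβ := angle_pos_of_not_collinear hABC
  have hγ := angle_pos_of_not_collinear (hset₁ ▸ hABC)
  have hα := angle_pos_of_not_collinear (hset₂ ▸ hABC)
  have hsγ := sin_pos_of_not_collinear (hset₁ ▸ hABC)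
  have hlaw₁ := law_sin A C B
  have hlaw₂ := law_sin B C A
  rw [angle_comm B C A] at hγ hsγ hlaw₂ hsum
  rw [angle_comm C A B] at hα hsum
  have hthree (x : ℝ) : 3 * (x / 3) = x := by ring
  have hkC : dist A B = dist A B / sin (∠ A C B) * sin (3 * (∠ A C B / 3)) := by
    rw [hthree]; field
  have hkA : dist B C = dist A B / sin (∠ A C B) * sin (3 * (∠ B A C / 3)) := by
    rw [hthree, dist_comm B C, dist_comm A B]; field_simp; linear_combination hlaw₁
  have hkB : dist C A = dist A B / sin (∠ A C B) * sin (3 * (∠ A B C / 3)) := by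
    rw [hthree]; field_simp; linear_combination hlaw₂
  have hk : 0 < dist A B / sin (∠ A C B) := div_pos (dist_pos.2 hAB) hsγ
  have hQR := dist_adjacent_trisectors (by positivity) (by positivity) (by positivity)
    (by linarith) (hthree _).symm hAB hAC hkC (dist_comm C A ▸ hkB) hk
    (interior_subset hQ) (interior_subset hR) hQ1 hQ2 hR1 hR2
  rw [hset₁] at hR hP
  have hRP := dist_adjacent_trisectors (by positivity) (by positivity) (by positivity)
    (by linarith) ((angle_comm _ _ _).trans (hthree _).symm) hBC hAB.symm hkA
    (dist_comm A B ▸ hkC) hk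
    (interior_subset hR) (interior_subset hP) hR1 hR2 hP1 hP2
  rw [← hset₁, hset₂] at hP
  rw [hset₂] at hQ
  have hPQ := dist_adjacent_trisectors (by positivity) (by positivity) (by positivity)
    (by linarith) (hthree _).symm hAC.symm hBC.symm hkB (dist_comm B C ▸ hkA) hk
    (interior_subset hP) (interior_subset hQ) hP1 hP2 hQ1 hQ2
  rw [hPQ, hQR, hRP]
  constructor <;> ring
end
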